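/- arXiv:0907.4311 — 2 statements merged into one kernel-verified Lean document; each statement's English description precedes it below -/
import Mathlib

section
/- Let t ≥ 2 be an integer. For every ε > 0 there exists a finite list I of items with sizes in (0, 1/t], a packing of I that is a (pure) Nash equilibrium using m bins, and a packing of I using n bins, such that m ≥ (ρ_t − ε)·n, where ρ_t = ( t² + ∑_{j=1}^∞ (t+1)^{−j}·2^{−j(j−1)/2} ) / ( t(t−1) + 1 ). Consequently the Price of Anarchy of the parametric bin packing game with item sizes at most 1/t is at least ρ_t. -/
/-- The load of bin `k` in the assignment `f` of items to `m` bins. -/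
noncomputable def binLoad {ι : Type*} [Fintype ι] (size : ι → ℝ) {m : ℕ}
    (f : ι → Fin m) (k : Fin m) : ℝ :=
  ∑ i ∈ Finset.univ.filter (fun i => f i = k), size i

/-- `f` is a packing of the items into `m` (nonempty) bins. -/
def IsPacking {ι : Type*} [Fintype ι] (size : ι → ℝ) (m : ℕ) (f : ι → Fin m) : Prop :=
  Function.Surjective f ∧ ∀ k : Fin m, binLoad size f k ≤ 1

/-- `f` is a (pure) Nash equilibrium packing. -/
def IsNE {ι : Type*} [Fintype ι] (size : ι → ℝ) (m : ℕ) (f : ι → Fin m) : Prop :=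
  IsPacking size m f ∧
    ∀ i : ι, ∀ k : Fin m, k ≠ f i → binLoad size f k + size i ≤ 1 →
      binLoad size f k + size i ≤ binLoad size f (f i)

open Finset

/-- The load of bin `k` when the bins are indexed by an arbitrary type. -/
noncomputable def load {ι β : Type} [Fintype ι] [DecidableEq β] (size : ι → ℝ) (f : ι → β)
    (k : β) : ℝ :=
  ∑ i, if f i = k then size i else 0

/-- `f` is an equilibrium packing and `g` a packing of the same items, where the bins of `f` have
load at most `1 - 1 / K + δ`, and so do the bins of `g` in the image of `o`, which can still be
filled with items of size about `1 / (2 * K)`. -/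
structure IsStage (t K : ℕ) (δ : ℝ) {ι α γ ρ : Type} [Fintype ι] [DecidableEq α] [DecidableEq γ]
    (size : ι → ℝ) (f : ι → α) (g : ι → γ) (o : ρ → γ) : Prop where
  size_le : ∀ i, size i ≤ 1 / t
  le_size : ∀ i, 1 / (2 * K) ≤ size i
  surj_left : Function.Surjective f
  surj_right : Function.Surjective g
  load_left : ∀ k, load size f k ≤ 1 - 1 / K + δ
  nash : ∀ i k, k ≠ f i → 1 < load size f k + size i ∨
    load size f k + size i ≤ load size f (f i)
  load_right : ∀ z, load size g z ≤ 1
  load_open : ∀ y, load size g (o y) ≤ 1 - 1 / K + δ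
  inj_open : Function.Injective o

/-- There are stages with `m` equilibrium bins, `n` bins in the other packing and `r` open bins,
for arbitrarily small excess `δ`. -/
def Attainable (t K r m n : ℕ) : Prop :=
  ∀ δ : ℝ, 0 < δ → ∃ (ι α γ ρ : Type) (_ : Fintype ι) (_ : Fintype α) (_ : Fintype γ)
    (_ : Fintype ρ) (_ : DecidableEq α) (_ : DecidableEq γ)
    (size : ι → ℝ) (f : ι → α) (g : ι → γ) (o : ρ → γ),
    IsStage t K δ size f g o ∧ Fintype.card α = m ∧ Fintype.card γ = n ∧ Fintype.card ρ = r

theorem load_sum {ι κ β : Type} [Fintype ι] [Fintype κ] [DecidableEq β] (s₁ : ι → ℝ) (s₂ : κ → ℝ)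
    (f₁ : ι → β) (f₂ : κ → β) (k : β) :
    load (Sum.elim s₁ s₂) (Sum.elim f₁ f₂) k = load s₁ f₁ k + load s₂ f₂ k := by
  simp only [load, Fintype.sum_sum_type, Sum.elim_inl, Sum.elim_inr]
  congr!

theorem load_comp_injective {ι β β' : Type} [Fintype ι] [DecidableEq β] [DecidableEq β']
    (s : ι → ℝ) (f : ι → β) {e : β → β'} (he : Function.Injective e) (k : β) :
    load s (fun i => e (f i)) (e k) = load s f k := by
  simp [load, he.eq_iff]

theorem load_eq_zero {ι β : Type} [Fintype ι] [DecidableEq β] (s : ι → ℝ) (f : ι → β) {k : β}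
    (h : ∀ i, f i ≠ k) : load s f k = 0 := by
  simp [load, h]

/-- An injective assignment puts at most one item into each bin. -/
theorem load_le_of_injective {ι β : Type} [Fintype ι] [DecidableEq β] (s : ι → ℝ) {f : ι → β}
    (hf : Function.Injective f) (k : β) {b : ℝ} (hb : 0 ≤ b) (h : ∀ i, f i = k → s i ≤ b) :
    load s f k ≤ b := by
  classical
  by_cases hk : ∃ i, f i = k
  · obtain ⟨i, rfl⟩ := hk
    simpa [load, hf.eq_iff] using h i rfl
  · push Not at hk
    rw [load_eq_zero s f hk]
    exact hb

/-- The items of a new bin: pairs of a slightly too large and a slightly too small item, and one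
single item. -/
noncomputable def levelSize (K : ℕ) (u : ℝ) {r P : ℕ} :
    Fin r × Option (Fin P × Bool) → ℝ
  | (_, none) => 1 / (2 * K) + (2 * r + 1) * u
  | (i, some (_, true)) => 1 / (2 * K) + (2 * (i : ℕ) + 1) * u
  | (i, some (_, false)) => 1 / (2 * K) - 2 * (i : ℕ) * u

def levelSlot {r P : ℕ} : Fin r × Option (Fin P × Bool) → Fin r ⊕ (Fin P × Fin (r + 1))
  | (i, none) => Sum.inl i
  | (i, some (q, true)) => Sum.inr (q, i.succ)
  | (i, some (q, false)) => Sum.inr (q, i.castSucc)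

theorem load_level_fst (K : ℕ) (u : ℝ) {r P : ℕ} (k : Fin r) :
    load (levelSize K u) (Prod.fst : Fin r × Option (Fin P × Bool) → Fin r) k =
      (2 * P + 1) * (1 / (2 * K)) + (P + (2 * r + 1)) * u := by
  simp only [load, Fintype.sum_prod_type, Fintype.sum_option, Fintype.sum_bool, levelSize]
  simp [Finset.sum_add_distrib]
  ring

theorem load_levelSlot_inl (K : ℕ) (u : ℝ) {r P : ℕ} (y : Fin r) :
    load (levelSize K u) (levelSlot : Fin r × Option (Fin P × Bool) → _) (Sum.inl y) =
      1 / (2 * K) + (2 * r + 1) * u := by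
  simp [load, Fintype.sum_prod_type, Fintype.sum_option, levelSize, levelSlot]

theorem load_levelSlot_inr_le (K : ℕ) {u : ℝ} (hu : 0 ≤ u) {r P : ℕ}
    (hu' : (2 * r + 1) * u ≤ 1 / (2 * K)) (q : Fin P) (j : Fin (r + 1)) :
    load (levelSize K u) (levelSlot : Fin r × Option (Fin P × Bool) → _) (Sum.inr (q, j)) ≤
      1 / K - u := by
  have hj : (j : ℝ) ≤ r := by exact_mod_cast Nat.lt_succ_iff.mp j.2
  have hju : (j : ℝ) * u ≤ r * u := by gcongr
  have hj0 : 0 ≤ (j : ℝ) * u := by positivity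
  have h₁ := load_le_of_injective (fun i : Fin r => 1 / (2 * (K : ℝ)) - 2 * (i : ℕ) * u)
    (Fin.castSucc_injective r) j (b := 1 / (2 * (K : ℝ)) - 2 * j * u) (by linarith)
    (by rintro i rfl; simp)
  have h₂ := load_le_of_injective (fun i : Fin r => 1 / (2 * (K : ℝ)) + (2 * (i : ℕ) + 1) * u)
    (Fin.succ_injective r) j (b := 1 / (2 * (K : ℝ)) + (2 * j - 1) * u) (by linarith)
    (by rintro i rfl; simp; linarith)
  have h : load (levelSize K u) (levelSlot : Fin r × Option (Fin P × Bool) → _) (Sum.inr (q, j)) =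
      load (fun i : Fin r => 1 / (2 * (K : ℝ)) + (2 * (i : ℕ) + 1) * u) Fin.succ j +
      load (fun i : Fin r => 1 / (2 * (K : ℝ)) - 2 * (i : ℕ) * u) Fin.castSucc j := by
    simp [load, Fintype.sum_prod_type, Fintype.sum_option, levelSize, levelSlot, ite_and,
      Finset.sum_add_distrib]
  have hK : 1 / (K : ℝ) = 2 * (1 / (2 * K)) := by ring
  rw [h, hK]
  linarith

theorem levelSize_le (K : ℕ) {u : ℝ} (hu : 0 ≤ u) {r P : ℕ}
    (x : Fin r × Option (Fin P × Bool)) :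
    levelSize K u x ≤ 1 / (2 * K) + (2 * r + 1) * u := by
  obtain ⟨i, _ | ⟨q, _ | _⟩⟩ := x
  · simp [levelSize]
  · have : 0 ≤ (i : ℝ) * u := by positivity
    have : 0 ≤ (r : ℝ) * u := by positivity
    simp only [levelSize]
    linarith
  · have hi : (i : ℝ) ≤ r := by exact_mod_cast i.2.le
    simp only [levelSize]
    gcongr

theorem le_levelSize (K : ℕ) {u : ℝ} (hu : 0 ≤ u) {r P : ℕ}
    (x : Fin r × Option (Fin P × Bool)) :
    1 / (2 * K) - 2 * r * u ≤ levelSize K u x := by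
  have h0 : 0 ≤ (r : ℝ) * u := by positivity
  obtain ⟨i, _ | ⟨q, _ | _⟩⟩ := x
  · simp only [levelSize]
    linarith
  · have hi : (i : ℝ) * u ≤ r * u := by
      gcongr
      exact_mod_cast i.2.le
    simp only [levelSize]
    linarith
  · have : 0 ≤ (i : ℝ) * u := by positivity
    simp only [levelSize]
    linarith

/-- Halving the item size: `r + 1 = K * (r' + 1)` open bins are filled with the items of `r'` new
equilibrium bins, leaving `r'` bins open. -/
theorem Attainable.succ {t K r m n : ℕ} (h : Attainable t K r m n) (hK : 2 ≤ K) (ht : 0 < t)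
    (htK : t ≤ K) {r' : ℕ} (hr : r + 1 = K * (r' + 1)) :
    Attainable t (2 * K) r' (m + r') n := by
  intro δ' hδ'
  obtain ⟨P, rfl⟩ : ∃ P, K = P + 1 := ⟨K - 1, by omega⟩
  have hP : (1 : ℝ) ≤ P := by exact_mod_cast (by omega : 1 ≤ P)
  set k : ℝ := 1 / (2 * ((P + 1 : ℕ) : ℝ)) with hk
  have hk0 : 0 < k := by positivity
  have hk2 : 1 / ((P + 1 : ℕ) : ℝ) = 2 * k := by rw [hk]; ring
  have hkP : (2 * P + 1) * k = 1 - k := by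
    rw [hk]; push_cast; field_simp; ring
  obtain ⟨u, hu, hu₁, hu₂⟩ : ∃ u : ℝ, 0 < u ∧ (P + (2 * r' + 1)) * u ≤ δ' ∧
      2 * ((2 * r' + 1) * u) ≤ k := by
    refine ⟨min (δ' / (P + (2 * r' + 1))) (k / (2 * (2 * r' + 1))), by positivity, ?_, ?_⟩
    · rw [mul_comm, ← le_div_iff₀ (by positivity)]
      exact min_le_left _ _
    · rw [← mul_assoc, mul_comm, ← le_div_iff₀ (by positivity)]
      exact min_le_right _ _
  have hr0 : 0 ≤ (r' : ℝ) * u := by positivity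
  have hPu : u ≤ P * u := by nlinarith
  obtain ⟨ι, α, γ, ρ, _, _, _, _, _, _, size, f, g, o, hs, hα, hγ, hρ⟩ := h u hu
  have hcard : Fintype.card (Fin r' ⊕ (Fin P × Fin (r' + 1))) = Fintype.card ρ := by
    simp only [Fintype.card_sum, Fintype.card_prod, Fintype.card_fin, hρ]
    linarith
  let e := Fintype.equivOfCardEq hcard
  have hoe : Function.Injective (fun x => o (e x)) := hs.inj_open.comp e.injective
  let F : ι ⊕ (Fin r' × Option (Fin P × Bool)) → α ⊕ Fin r' := Sum.map f Prod.fst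
  let G : ι ⊕ (Fin r' × Option (Fin P × Bool)) → γ := Sum.elim g fun x => o (e (levelSlot x))
  let s : ι ⊕ (Fin r' × Option (Fin P × Bool)) → ℝ := Sum.elim size (levelSize (P + 1) u)
  have hFl : ∀ a, load s F (Sum.inl a) = load size f a := by
    intro a; simp [load, F, s]
  have hFr : ∀ i, load s F (Sum.inr i) = 1 - k + (P + (2 * r' + 1)) * u := by
    intro i
    have := load_level_fst (P + 1) u (P := P) i
    rw [← hk, hkP] at this
    rw [← this]
    simp [load, F, s]
  have hG : ∀ z, load s G z =
      load size g z + load (levelSize (P + 1) u) (fun x => o (e (levelSlot x))) z :=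
    fun z => load_sum _ _ _ _ z
  have hGo : ∀ x, load (levelSize (P + 1) u) (fun x => o (e (levelSlot x))) (o (e x)) =
      load (levelSize (P + 1) u) (levelSlot (P := P)) x :=
    fun x => load_comp_injective _ _ hoe x
  have hGinl : ∀ y : Fin r', load s G (o (e (Sum.inl y))) ≤ 1 - k + (u + (2 * r' + 1) * u) := by
    intro y
    rw [hG, hGo, load_levelSlot_inl, ← hk]
    have := hs.load_open (e (Sum.inl y))
    rw [hk2] at this
    linarith
  have hkk : 1 / (((2 * (P + 1) : ℕ)) : ℝ) = k := by rw [hk]; push_cast; rfl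
  have hkk2 : 1 / (2 * ((2 * (P + 1) : ℕ) : ℝ)) = k / 2 := by rw [hk]; push_cast; field_simp
  refine ⟨_, _, γ, Fin r', inferInstance, inferInstance, inferInstance, inferInstance,
    inferInstance, inferInstance, s, F, G, fun y => o (e (Sum.inl y)), ?_, ?_, hγ, by simp⟩
  · constructor
    · rintro (i | x)
      · exact hs.size_le i
      · have h₁ := levelSize_le (P + 1) hu.le x
        have h₂ : 1 / ((P + 1 : ℕ) : ℝ) ≤ 1 / t := by
          gcongr
        rw [hk2] at h₂
        rw [← hk] at h₁
        change levelSize (P + 1) u x ≤ _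
        linarith
    · rw [hkk2]
      rintro (i | x)
      · have := hs.le_size i
        change _ ≤ size i
        linarith
      · have := le_levelSize (P + 1) hu.le x
        change _ ≤ levelSize (P + 1) u x
        rw [← hk] at this
        linarith
    · exact Sum.map_surjective.mpr ⟨hs.surj_left, fun i => ⟨(i, none), rfl⟩⟩
    · intro z
      obtain ⟨i, rfl⟩ := hs.surj_right z
      exact ⟨Sum.inl i, rfl⟩
    · rw [hkk]
      rintro (a | i)
      · rw [hFl]
        have := hs.load_left a
        rw [hk2] at this
        linarith
      · rw [hFr]
        linarith
    · rintro (i | x) (a | y) hne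
      · rw [hFl]
        have := hs.nash i a (fun h => hne (congrArg Sum.inl h))
        change _ ∨ _ ≤ load s F (Sum.inl (f i))
        rw [hFl]
        exact this
      · left
        rw [hFr]
        have := hs.le_size i
        change _ < _ + size i
        linarith
      · right
        change _ + levelSize (P + 1) u x ≤ load s F (Sum.inr x.1)
        rw [hFr, hFl]
        have h₁ := hs.load_left a
        have h₂ := levelSize_le (P + 1) hu.le x
        rw [hk2] at h₁
        rw [← hk] at h₂
        linarith
      · left
        rw [hFr]
        have := le_levelSize (P + 1) hu.le x
        change _ < _ + levelSize (P + 1) u x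
        rw [← hk] at this
        linarith
    · intro z
      by_cases hz : ∃ x, o (e x) = z
      · obtain ⟨y | ⟨q, j⟩, rfl⟩ := hz
        · have := hGinl y
          linarith
        · rw [hG, hGo]
          have h₁ := hs.load_open (e (Sum.inr (q, j)))
          have h₂ := load_levelSlot_inr_le (P + 1) hu.le (by rw [← hk]; linarith) q j
          linarith
      · push Not at hz
        rw [hG, load_eq_zero _ _ (fun x => hz _), add_zero]
        exact hs.load_right z
    · intro y
      have := hGinl y
      rw [hkk]
      linarith
    · exact hoe.comp Sum.inl_injective
  · simp [hα]

/-- Items of size about `1 / (t + 1)` with `t = T + 2`, packed in `t * c` equilibrium bins with one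
large item each. -/
noncomputable def mixedSize (T b : ℕ) (η : ℝ) {c : ℕ} :
    (Fin (T + 2) × Fin c) × Option (Fin (T + 1)) → ℝ
  | (_, none) => 1 / (T + 3) + ((T + 2) ^ 2 * b + 1) * η
  | (_, some _) => 1 / (T + 3) - (T + 2) * b * η

/-- Items of size about `1 / (t + 1)` with `t = T + 2`, packed in `b` equilibrium bins without
large items. -/
noncomputable def uniformSize (T : ℕ) (η : ℝ) {b : ℕ} : Fin b × (Bool ⊕ Fin T) → ℝ
  | (i, Sum.inl true) => 1 / (T + 3) + (b + (i : ℕ) + 1) * η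
  | (i, Sum.inl false) => 1 / (T + 3) + (b - (i : ℕ)) * η
  | (_, Sum.inr _) => 1 / (T + 3) + b * η

def mixedSlot {T b c : ℕ} (e : (Fin (T + 2) × Fin c) × Fin (T + 1) ≃ Fin (b + 1)) :
    (Fin (T + 2) × Fin c) × Option (Fin (T + 1)) → Fin (b + 1) ⊕ Fin c
  | (p, none) => Sum.inr p.2
  | (p, some k) => Sum.inl (e (p, k))

def uniformSlot {T b : ℕ} : Fin b × (Bool ⊕ Fin T) → Fin (b + 1)
  | (i, Sum.inl true) => i.succ
  | (i, Sum.inl false) => i.castSucc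
  | (i, Sum.inr _) => i.castSucc

theorem load_mixed_fst (T b : ℕ) (η : ℝ) {c : ℕ} (k : Fin (T + 2) × Fin c) :
    load (mixedSize T b η) Prod.fst k = (T + 2) * (1 / (T + 3)) + ((T + 2) * b + 1) * η := by
  have h : load (mixedSize T b η) Prod.fst k =
      ∑ x : Option (Fin (T + 1)), mixedSize T b η (k, x) := by
    rw [load, Fintype.sum_prod_type, Finset.sum_eq_single k] <;> simp +contextual
  rw [h, Fintype.sum_option]
  simp [mixedSize]
  ring

theorem load_uniform_fst (T : ℕ) (η : ℝ) {b : ℕ} (k : Fin b) :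
    load (uniformSize T η) Prod.fst k = (T + 2) * (1 / (T + 3)) + ((T + 2) * b + 1) * η := by
  have h : load (uniformSize T η) Prod.fst k =
      ∑ x : Bool ⊕ Fin T, uniformSize T η (k, x) := by
    rw [load, Fintype.sum_prod_type, Finset.sum_eq_single k] <;> simp +contextual
  rw [h, Fintype.sum_sum_type]
  simp [uniformSize]
  ring

theorem load_mixedSlot_inr (T : ℕ) {b c : ℕ} (η : ℝ)
    (e : (Fin (T + 2) × Fin c) × Fin (T + 1) ≃ Fin (b + 1)) (y : Fin c) :
    load (mixedSize T b η) (mixedSlot e) (Sum.inr y) =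
      (T + 2) * (1 / (T + 3) + ((T + 2) ^ 2 * b + 1) * η) := by
  simp [load, Fintype.sum_prod_type, Fintype.sum_option, mixedSize, mixedSlot]
  ring

theorem load_mixedSlot_inl (T : ℕ) {b c : ℕ} (η : ℝ)
    (e : (Fin (T + 2) × Fin c) × Fin (T + 1) ≃ Fin (b + 1)) (j : Fin (b + 1)) :
    load (mixedSize T b η) (mixedSlot e) (Sum.inl j) = 1 / (T + 3) - (T + 2) * b * η := by
  have h : load (mixedSize T b η) (mixedSlot e) (Sum.inl j) =
      ∑ x : (Fin (T + 2) × Fin c) × Fin (T + 1),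
        if e x = j then 1 / (T + 3 : ℝ) - (T + 2) * b * η else 0 := by
    rw [load, Fintype.sum_prod_type,
      Fintype.sum_prod_type (α₁ := Fin (T + 2) × Fin c) (α₂ := Fin (T + 1))]
    simp [Fintype.sum_option, mixedSize, mixedSlot]
  rw [h]
  simp [← Equiv.eq_symm_apply]

theorem load_uniformSlot_le (T : ℕ) {η : ℝ} (hη : 0 ≤ η) {b : ℕ} (j : Fin (b + 1)) :
    load (uniformSize T η) uniformSlot j ≤ (T + 2) * (1 / (T + 3)) + (T + 2) * b * η := by
  have hj : (j : ℝ) ≤ b := by exact_mod_cast Nat.lt_succ_iff.mp j.2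
  have h0 : (0 : ℝ) ≤ 1 / (T + 3) := by positivity
  have h1 : 0 ≤ (b - (j : ℝ)) * η := mul_nonneg (by linarith) hη
  have h2 : 0 ≤ (b + (j : ℝ)) * η := by positivity
  have h3 : 0 ≤ b * η := by positivity
  have h₁ := load_le_of_injective (fun i : Fin b => 1 / (T + 3 : ℝ) + (b + (i : ℕ) + 1) * η)
    (Fin.succ_injective b) j (b := 1 / (T + 3) + (b + (j : ℝ)) * η) (by linarith)
    (by rintro i rfl; simp; linarith)
  have h₂ := load_le_of_injective (fun i : Fin b => 1 / (T + 3 : ℝ) + (b - (i : ℕ)) * η)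
    (Fin.castSucc_injective b) j (b := 1 / (T + 3) + (b - (j : ℝ)) * η) (by linarith)
    (by rintro i rfl; simp)
  have h₃ := load_le_of_injective (fun _ : Fin b => 1 / (T + 3 : ℝ) + b * η)
    (Fin.castSucc_injective b) j (b := 1 / (T + 3) + b * η) (by linarith)
    (by rintro i rfl; simp)
  have h : load (uniformSize T η) uniformSlot j =
      load (fun i : Fin b => 1 / (T + 3 : ℝ) + (b + (i : ℕ) + 1) * η) Fin.succ j +
      load (fun i : Fin b => 1 / (T + 3 : ℝ) + (b - (i : ℕ)) * η) Fin.castSucc j +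
      T * load (fun _ : Fin b => 1 / (T + 3 : ℝ) + b * η) Fin.castSucc j := by
    simp only [load, Fintype.sum_prod_type, Fintype.sum_sum_type, Fintype.sum_bool, uniformSize,
      uniformSlot, Finset.sum_add_distrib, Finset.mul_sum]
    simp [mul_add]
  rw [h]
  have := mul_le_mul_of_nonneg_left h₃ (Nat.cast_nonneg (α := ℝ) T)
  linarith

theorem attainable_base (T c b : ℕ) (hb : b + 1 = (T + 2) * c * (T + 1)) :
    Attainable (T + 2) (T + 3) c ((T + 2) * c + b) (b + 1 + c) := by
  intro δ hδ
  set k : ℝ := 1 / (T + 3) with hk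
  have hk0 : 0 < k := by positivity
  have hkT : (T + 3) * k = 1 := by rw [hk]; field_simp
  obtain ⟨η, hη, hη₁, hη₂⟩ : ∃ η : ℝ, 0 < η ∧ (T + 2) * (((T + 2) ^ 2 * b + 1) * η) ≤ δ ∧
      (T + 2) * (((T + 2) ^ 2 * b + 1) * η) ≤ k := by
    refine ⟨min δ k / ((T + 2) * ((T + 2) ^ 2 * b + 1)), by positivity, ?_, ?_⟩
    · rw [← mul_assoc, mul_div_cancel₀ _ (by positivity)]
      exact min_le_left _ _
    · rw [← mul_assoc, mul_div_cancel₀ _ (by positivity)]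
      exact min_le_right _ _
  have hbη : 0 ≤ b * η := by positivity
  have hTbη : 0 ≤ T * (b * η) := by positivity
  have hTTbη : 0 ≤ T * (T * (b * η)) := by positivity
  let e : (Fin (T + 2) × Fin c) × Fin (T + 1) ≃ Fin (b + 1) :=
    Fintype.equivOfCardEq (by simp [hb])
  let s : ((Fin (T + 2) × Fin c) × Option (Fin (T + 1))) ⊕ (Fin b × (Bool ⊕ Fin T)) → ℝ :=
    Sum.elim (mixedSize T b η) (uniformSize T η)
  let F : ((Fin (T + 2) × Fin c) × Option (Fin (T + 1))) ⊕ (Fin b × (Bool ⊕ Fin T)) →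
    (Fin (T + 2) × Fin c) ⊕ Fin b := Sum.map Prod.fst Prod.fst
  let G : ((Fin (T + 2) × Fin c) × Option (Fin (T + 1))) ⊕ (Fin b × (Bool ⊕ Fin T)) →
    Fin (b + 1) ⊕ Fin c := Sum.elim (mixedSlot e) (fun x => Sum.inl (uniformSlot x))
  have hF : ∀ a, load s F a = 1 - k + ((T + 2) * b + 1) * η := by
    have hk1 : 1 - k = (T + 2) * k := by linarith
    rw [hk1]
    rintro (a | a)
    · rw [← load_mixed_fst T b η a]
      simp [load, F, s]
    · rw [← load_uniform_fst T η a]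
      simp [load, F, s]
  have hGl : ∀ j, load s G (Sum.inl j) ≤ 1 := by
    intro j
    rw [show load s G (Sum.inl j) = _ from load_sum _ _ _ _ _,
      load_comp_injective _ _ Sum.inl_injective, load_mixedSlot_inl]
    have := load_uniformSlot_le T hη.le j
    rw [← hk] at this ⊢
    linarith
  have hGr : ∀ y, load s G (Sum.inr y) =
      1 - k + (T + 2) * (((T + 2) ^ 2 * b + 1) * η) := by
    intro y
    rw [show load s G (Sum.inr y) = _ from load_sum _ _ _ _ _,
      load_eq_zero _ _ (fun x => Sum.inl_ne_inr), load_mixedSlot_inr, ← hk]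
    linarith
  have hlow : ∀ x, k - (T + 2) * b * η ≤ s x := by
    rintro (⟨p, _ | q⟩ | ⟨i, (_ | _) | q⟩) <;>
      simp only [s, Sum.elim_inl, Sum.elim_inr, mixedSize, uniformSize, ← hk]
    · nlinarith
    · linarith
    · have : (i : ℝ) * η ≤ b * η := by
        gcongr
        exact_mod_cast i.2.le
      linarith
    · have : 0 ≤ (i : ℝ) * η := by positivity
      linarith
    · linarith
  have hup : ∀ x, s x ≤ k + ((T + 2) ^ 2 * b + 1) * η := by
    rintro (⟨p, _ | q⟩ | ⟨i, (_ | _) | q⟩) <;>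
      simp only [s, Sum.elim_inl, Sum.elim_inr, mixedSize, uniformSize, ← hk]
    · linarith
    · linarith
    · have : 0 ≤ (i : ℝ) * η := by positivity
      linarith
    · have : (i : ℝ) * η ≤ b * η := by
        gcongr
        exact_mod_cast i.2.le
      linarith
    · linarith
  have hk3 : 1 / ((T + 3 : ℕ) : ℝ) = k := by rw [hk]; push_cast; rfl
  have hk3' : 1 / (2 * ((T + 3 : ℕ) : ℝ)) = k / 2 := by rw [hk]; push_cast; field_simp
  have hT2 : 1 / ((T + 2 : ℕ) : ℝ) = k + k / (T + 2) := by
    rw [hk]; push_cast; field_simp; ring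
  refine ⟨_, _, _, Fin c, inferInstance, inferInstance, inferInstance, inferInstance,
    inferInstance, inferInstance, s, F, G, Sum.inr, ?_, by simp, by simp, by simp⟩
  constructor
  · intro x
    have h₁ : ((T + 2) ^ 2 * b + 1) * η ≤ k / (T + 2) := by
      rw [le_div_iff₀ (by positivity)]
      linarith
    rw [hT2]
    exact (hup x).trans (by linarith)
  · intro x
    rw [hk3']
    refine le_trans ?_ (hlow x)
    nlinarith
  · refine Sum.map_surjective.mpr ⟨fun p => ⟨(p, none), rfl⟩, fun i => ⟨(i, Sum.inl true), rfl⟩⟩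
  · rintro (j | y)
    · exact ⟨Sum.inl ((e.symm j).1, some (e.symm j).2), by simp [G, mixedSlot]⟩
    · exact ⟨Sum.inl ((0, y), none), rfl⟩
  · intro a
    rw [hF, hk3]
    nlinarith
  · intro x a _
    left
    rw [hF]
    have := hlow x
    linarith
  · rintro (j | y)
    · exact hGl j
    · rw [hGr]
      linarith
  · intro y
    rw [hGr, hk3]
    linarith
  · exact Sum.inr_injective

/-- Iterated halving. -/
theorem Attainable.iterate {t r m n : ℕ} (h : Attainable t (t + 1) r m n) (ht : 0 < t) (s : ℕ) :
    ∀ X : ℕ, 0 < X → r + 1 = (t + 1) ^ s * 2 ^ (s * (s - 1) / 2) * X →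
      ∃ m' : ℕ, Attainable t (2 ^ s * (t + 1)) (X - 1) m' n ∧
        (m' : ℝ) = m + ∑ j ∈ range s, ((r : ℝ) + 1) *
          (1 / (((t : ℝ) + 1) ^ (j + 1) * 2 ^ (j * (j + 1) / 2))) - s := by
  induction s with
  | zero =>
    intro X _ hX
    simp only [pow_zero, Nat.zero_mul, Nat.zero_div, one_mul] at hX ⊢
    exact ⟨m, by rwa [← hX, Nat.add_sub_cancel], by simp⟩
  | succ s ih =>
    intro X hX0 hX
    have hX' : r + 1 = (t + 1) ^ s * 2 ^ (s * (s - 1) / 2) * (2 ^ s * (t + 1) * X) := by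
      rw [hX, Nat.triangle_succ]
      ring
    have hpos : 0 < 2 ^ s * (t + 1) * X := by positivity
    obtain ⟨m', hm', hm'r⟩ := ih _ hpos hX'
    have hle : t + 1 ≤ 2 ^ s * (t + 1) := Nat.le_mul_of_pos_left _ (by positivity)
    have hstep := hm'.succ (by omega) ht (by omega) (r' := X - 1)
      (by rw [Nat.sub_add_cancel hX0, Nat.sub_add_cancel hpos])
    refine ⟨m' + (X - 1), by convert hstep using 1; ring, ?_⟩
    have hXr : ((r : ℝ) + 1) * (1 / (((t : ℝ) + 1) ^ (s + 1) * 2 ^ (s * (s + 1) / 2))) = X := by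
      have h₁ : ((r : ℝ) + 1) = (t + 1) ^ (s + 1) * 2 ^ (s * (s + 1) / 2) * X := by
        have h₂ := hX
        rw [Nat.add_sub_cancel, mul_comm (s + 1) s] at h₂
        exact_mod_cast h₂
      rw [h₁]
      field_simp
    rw [sum_range_succ, hXr]
    push_cast [Nat.cast_sub hX0, hm'r]
    ring

theorem Attainable.exists_packings {t K r m n : ℕ} (h : Attainable t K r m n) (hK : 0 < K) :
    ∃ (N : ℕ) (size : Fin N → ℝ) (f : Fin N → Fin m) (g : Fin N → Fin n),
      (∀ i, size i ∈ Set.Ioc (0 : ℝ) (1 / (t : ℝ))) ∧ IsNE size m f ∧ IsPacking size n g := by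
  have hK0 : (0 : ℝ) < 1 / K := by positivity
  obtain ⟨ι, α, γ, ρ, _, _, _, _, _, _, size, f, g, o, hs, hα, hγ, -⟩ := h (1 / K) hK0
  let eι := Fintype.equivFin ι
  let eα := Fintype.equivFinOfCardEq hα
  let eγ := Fintype.equivFinOfCardEq hγ
  have hload : ∀ {β : Type} [DecidableEq β] {l : ℕ} (e : β ≃ Fin l) (φ : ι → β) (k : Fin l),
      binLoad (fun i => size (eι.symm i)) (fun i => e (φ (eι.symm i))) k =
        load size φ (e.symm k) := by
    intro β _ l e φ k
    rw [binLoad, sum_filter, load]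
    rw [← Equiv.sum_comp eι.symm]
    simp [Equiv.eq_symm_apply]
  refine ⟨_, fun i => size (eι.symm i), fun i => eα (f (eι.symm i)),
    fun i => eγ (g (eι.symm i)), fun i => ⟨?_, hs.size_le _⟩, ⟨⟨?_, fun k => ?_⟩, fun i k hk => ?_⟩,
    ?_, fun k => ?_⟩
  · exact lt_of_lt_of_le (by positivity) (hs.le_size _)
  · exact eα.surjective.comp (hs.surj_left.comp eι.symm.surjective)
  · rw [hload]
    linarith [hs.load_left (eα.symm k)]
  · rw [hload, hload, Equiv.symm_apply_apply]
    intro hfit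
    rcases hs.nash (eι.symm i) (eα.symm k) (fun h => hk (by simp [← h])) with h | h
    · linarith
    · exact h
  · exact eγ.surjective.comp (hs.surj_right.comp eι.symm.surjective)
  · rw [hload]
    exact hs.load_right _

theorem summable_inv_pow_mul_two_pow (t : ℕ) (ht : 0 < t) :
    Summable fun j : ℕ => 1 / (((t : ℝ) + 1) ^ (j + 1) * 2 ^ (j * (j + 1) / 2)) := by
  have ht' : (0 : ℝ) < t := by exact_mod_cast ht
  have hgeom : Summable fun j : ℕ => (1 / ((t : ℝ) + 1)) ^ (j + 1) :=
    (summable_nat_add_iff 1).mpr (summable_geometric_of_lt_one (by positivity)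
      ((div_lt_one (by positivity)).mpr (by linarith)))
  refine Summable.of_nonneg_of_le (fun j => by positivity) (fun j => ?_) hgeom
  rw [one_div_pow]
  apply one_div_le_one_div_of_le (by positivity)
  exact le_mul_of_one_le_right (by positivity) (one_le_pow₀ (by norm_num))

/-- Lower bound on the Price of Anarchy of the parametric bin packing game with
item sizes at most `1/t`: for every `ε > 0` there is an instance, an NE packing
of it into `m` bins and a packing into `n` bins, with `m ≥ (ρ_t - ε)·n` where
`ρ_t = (t² + ∑_{j=1}^∞ (t+1)^{-j}·2^{-j(j-1)/2})/(t(t-1) + 1)`. -/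
theorem poa_parametric_lower_bound (t : ℕ) (ht : 2 ≤ t) (ε : ℝ) (hε : 0 < ε) :
    ∃ (N m n : ℕ) (size : Fin N → ℝ) (f : Fin N → Fin m) (g : Fin N → Fin n),
      (∀ i, size i ∈ Set.Ioc (0 : ℝ) (1 / (t : ℝ))) ∧
      IsNE size m f ∧ IsPacking size n g ∧
      ((((t : ℝ) ^ 2
            + ∑' j : ℕ, 1 / (((t : ℝ) + 1) ^ (j + 1) * 2 ^ (j * (j + 1) / 2)))
          / ((t : ℝ) * ((t : ℝ) - 1) + 1)) - ε) * n ≤ (m : ℝ) := by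
  obtain ⟨T, rfl⟩ : ∃ T, t = T + 2 := ⟨t - 2, by omega⟩
  set a : ℕ → ℝ := fun j => 1 / ((((T + 2 : ℕ) : ℝ) + 1) ^ (j + 1) * 2 ^ (j * (j + 1) / 2)) with ha
  have ha0 : ∀ j, 0 ≤ a j := fun j => by positivity
  obtain ⟨s, hs⟩ : ∃ s, ∑' j, a j - ε / 2 < ∑ j ∈ range s, a j :=
    ((summable_inv_pow_mul_two_pow (T + 2) (by omega)).hasSum.tendsto_sum_nat.eventually
      (lt_mem_nhds (by linarith))).exists
  obtain ⟨Y, hY⟩ := exists_nat_ge (2 * (s + 1) / ε)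
  obtain ⟨c, hc⟩ : ∃ c, c + 1 = (T + 2 + 1) ^ s * 2 ^ (s * (s - 1) / 2) * (Y + 2) :=
    ⟨(T + 2 + 1) ^ s * 2 ^ (s * (s - 1) / 2) * (Y + 2) - 1, Nat.sub_add_cancel (by
      have : 0 < (T + 2 + 1) ^ s * 2 ^ (s * (s - 1) / 2) * (Y + 2) := by positivity
      omega)⟩
  have hcY : Y + 1 ≤ c := by
    have : Y + 2 ≤ c + 1 := hc ▸ Nat.le_mul_of_pos_left _ (by positivity)
    omega
  obtain ⟨b, hb⟩ : ∃ b, b + 1 = (T + 2) * c * (T + 1) :=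
    ⟨(T + 2) * c * (T + 1) - 1, Nat.sub_add_cancel (by
      have : 0 < c := by omega
      have : 0 < (T + 2) * c * (T + 1) := by positivity
      omega)⟩
  obtain ⟨m, hm, hmr⟩ := (attainable_base T c b hb).iterate (by omega) s (Y + 2) (by omega) hc
  obtain ⟨N, size, f, g, h₁, h₂, h₃⟩ := hm.exists_packings (by positivity)
  refine ⟨N, m, b + 1 + c, size, f, g, h₁, h₂, h₃, ?_⟩
  rw [← mul_sum] at hmr
  have hbr : (b : ℝ) + 1 = (T + 2) * c * (T + 1) := by exact_mod_cast hb
  have hcr : 2 * ((s : ℝ) + 1) ≤ c * ε := by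
    rw [div_le_iff₀ hε] at hY
    have : (Y : ℝ) ≤ c := by exact_mod_cast (by omega : Y ≤ c)
    exact hY.trans (by gcongr)
  have hc0 : (0 : ℝ) ≤ c := by positivity
  have hA : 0 ≤ ∑ j ∈ range s, a j := sum_nonneg fun j _ => ha0 j
  have hD : (0 : ℝ) < ((T + 2 : ℕ) : ℝ) * (((T + 2 : ℕ) : ℝ) - 1) + 1 := by
    push_cast
    nlinarith [Nat.cast_nonneg (α := ℝ) T]
  have hn : ((b + 1 + c : ℕ) : ℝ) = (((T + 2 : ℕ) : ℝ) * (((T + 2 : ℕ) : ℝ) - 1) + 1) * c := by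
    push_cast
    rw [hbr]
    ring
  have hεD : ε * c ≤ ε * ((((T + 2 : ℕ) : ℝ) * (((T + 2 : ℕ) : ℝ) - 1) + 1) * c) := by
    have : (1 : ℝ) ≤ ((T + 2 : ℕ) : ℝ) * (((T + 2 : ℕ) : ℝ) - 1) + 1 := by
      push_cast
      nlinarith [Nat.cast_nonneg (α := ℝ) T]
    gcongr
    exact le_mul_of_one_le_left hc0 this
  have htail := mul_le_mul_of_nonneg_right hs.le hc0
  change (m : ℝ) = _ + ((c : ℝ) + 1) * (∑ j ∈ range s, a j) - s at hmr
  rw [sub_mul, hn, ← mul_assoc, div_mul_cancel₀ _ hD.ne', hmr]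
  clear_value a
  push_cast at hbr hεD ⊢
  linarith
end

section
/- Let t ≥ 2 be an integer and let I be a finite list of items, each with a real size in (0, 1/t]. In every packing of I that is a (pure) Nash equilibrium, all bins except at most two have total size (load) strictly greater than t/(t+1). -/
namespace IsNE

variable {ι : Type*} [Fintype ι] {size : ι → ℝ} {m : ℕ} {f : ι → Fin m}

/-- In an NE packing, no item fits into another bin of at least the same load. -/
lemma one_lt_binLoad_add (hf : IsNE size m f) {i : ι} (hi : 0 < size i) {k : Fin m}
    (hk : k ≠ f i) (hle : binLoad size f (f i) ≤ binLoad size f k) :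
    1 < binLoad size f k + size i := by
  by_contra! h
  linarith [hf.2 i k hk h]

/-- If items have sizes in `(0, 1/t]`, then the fullest of any three distinct bins of an NE packing
has load greater than `t/(t+1)`. -/
lemma lt_binLoad_of_le_of_le (hf : IsNE size m f) {t : ℕ} (ht : 0 < t)
    (hsize : ∀ i, size i ∈ Set.Ioc (0 : ℝ) (1 / (t : ℝ))) {a b c : Fin m}
    (hab : a ≠ b) (hac : a ≠ c) (hbc : b ≠ c)
    (hba : binLoad size f b ≤ binLoad size f a) (hcb : binLoad size f c ≤ binLoad size f b) :
    (t : ℝ) / ((t : ℝ) + 1) < binLoad size f a := by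
  by_contra! ha
  have ht' : (0 : ℝ) < t := by exact_mod_cast ht
  have hone : (t : ℝ) / (t + 1) + 1 / (t + 1) = 1 := by field_simp
  obtain ⟨i, rfl⟩ := hf.1.1 c
  set S := Finset.univ.filter (fun j => f j = b) with hS
  have hlow : ∀ j ∈ S, 1 / ((t : ℝ) + 1) ≤ size j := by
    intro j hj
    obtain rfl : f j = b := by simpa [hS] using hj
    have h := hf.one_lt_binLoad_add (hsize j).1 hab hba
    linarith
  have hstrict : S.card * (1 / ((t : ℝ) + 1)) < (t : ℝ) / (t + 1) := by
    obtain ⟨j, hj⟩ := hf.1.1 b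
    have h := hf.one_lt_binLoad_add (hsize j).1 (hj ▸ hab) (hj ▸ hba)
    calc S.card * (1 / ((t : ℝ) + 1)) = ∑ _j ∈ S, 1 / ((t : ℝ) + 1) := by simp
      _ < ∑ j ∈ S, size j :=
        Finset.sum_lt_sum hlow ⟨j, by simp [hS, hj], by linarith⟩
      _ ≤ _ := hba.trans ha
  have hcard : (S.card : ℝ) + 1 ≤ t := by
    rw [mul_one_div, div_lt_div_iff_of_pos_right (by positivity)] at hstrict
    exact_mod_cast hstrict
  have hup : binLoad size f b ≤ S.card * (1 / (t : ℝ)) := by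
    simpa [binLoad, hS] using Finset.sum_le_card_nsmul S size (1 / (t : ℝ)) fun j _ => (hsize j).2
  have h := hf.one_lt_binLoad_add (hsize i).1 hbc hcb
  have hmul : ((S.card : ℝ) + 1) * (1 / (t : ℝ)) ≤ t * (1 / (t : ℝ)) := by gcongr
  rw [mul_one_div_cancel ht'.ne'] at hmul
  linarith [(hsize i).2]

end IsNE

/-- In every NE packing of items with sizes in `(0, 1/t]` (`t ≥ 2`), all bins
except at most two have load strictly greater than `t/(t+1)`. -/
theorem ne_bins_almost_full (t : ℕ) (ht : 2 ≤ t) {ι : Type*} [Fintype ι]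
    (size : ι → ℝ) (hsize : ∀ i, size i ∈ Set.Ioc (0 : ℝ) (1 / (t : ℝ))) {m : ℕ}
    (f : ι → Fin m) (hf : IsNE size m f) :
    {k : Fin m | binLoad size f k ≤ (t : ℝ) / ((t : ℝ) + 1)}.ncard ≤ 2 := by
  by_contra! h
  obtain ⟨a, ha, b, hb, c, hc, hab, hac, hbc⟩ := (Set.two_lt_ncard (Set.toFinite _)).1 h
  have key := @IsNE.lt_binLoad_of_le_of_le ι _ size m f hf t (by omega) hsize
  simp only [Set.mem_ofPred_eq] at ha hb hc
  rcases le_total (binLoad size f a) (binLoad size f b) with h₁ | h₁ <;>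
  rcases le_total (binLoad size f b) (binLoad size f c) with h₂ | h₂ <;>
  rcases le_total (binLoad size f a) (binLoad size f c) with h₃ | h₃
  · exact hc.not_gt (key hbc.symm hac.symm hab.symm h₂ h₁)
  · exact hc.not_gt (key hbc.symm hac.symm hab.symm h₂ h₁)
  · exact hb.not_gt (key hbc hab.symm hac.symm h₂ h₃)
  · exact hb.not_gt (key hab.symm hbc hac h₁ h₃)
  · exact hc.not_gt (key hac.symm hbc.symm hab h₃ h₁)
  · exact ha.not_gt (key hac hab hbc.symm h₃ h₂)
  · exact ha.not_gt (key hab hac hbc h₁ h₂)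
  · exact ha.not_gt (key hab hac hbc h₁ h₂)
end
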